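/- Let G be a locally finite group and let φ be an automorphism of G. Then for every positive integer n, h(φ) = h(φ↾_{Z_n(G)}) + h(φ̄), where Z_n(G) is the n-th term of the upper central series of G and φ̄ is the automorphism induced by φ on G/Z_n(G). -/

import Mathlib

open scoped Pointwise ENNReal

/-- A group is *locally finite* if every finitely generated subgroup is finite. -/
def IsLocallyFinite (G : Type*) [Group G] : Prop :=
  ∀ S : Set G, S.Finite → (Subgroup.closure S : Set G).Finite

namespace AlgEntropy

variable {G : Type*} [Group G]

/-- `entTraj φ F n` is the `n`-th trajectory `T_n(φ,F) = F·φ(F)···φ^{n-1}(F)`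
(with `T_0 = {1}`). -/
def entTraj (φ : G →* G) (F : Set G) : ℕ → Set G
  | 0 => {1}
  | n + 1 => entTraj φ F n * (⇑φ)^[n] '' F

/-- The algebraic entropy of `φ` with respect to a subgroup `F`:
`H(φ,F) = lim_n (1/n)·log|T_n(φ,F)|` (the limit exists when `G` is locally
finite and `F` is finite, and then it coincides with this `limsup`). -/
noncomputable def entH (φ : G →* G) (F : Subgroup G) : ℝ :=
  Filter.limsup (fun n : ℕ => Real.log (entTraj φ (F : Set G) n).ncard / n) Filter.atTop

/-- The algebraic entropy `h(φ) = sup { H(φ,F) : F ≤ G finite }`, valued in `[0,∞]`. -/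
noncomputable def algEnt (φ : G →* G) : ℝ≥0∞ :=
  ⨆ (F : Subgroup G) (_ : (F : Set G).Finite), ENNReal.ofReal (entH φ F)

/-- The restriction of an endomorphism `φ` to a `φ`-invariant subgroup `H`. -/
def endRestrict (φ : G →* G) (H : Subgroup G) (hH : H ≤ H.comap φ) : H →* H :=
  (φ.domRestrict H).codRestrict H (fun x => hH x.2)

/-- The entropy of the endomorphism induced by `φ` on the quotient `G ⧸ H`. -/
noncomputable def entQuot (φ : G →* G) (H : Subgroup G) (hN : H.Normal)
    (hH : H ≤ H.comap φ) : ℝ≥0∞ :=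
  letI := hN
  algEnt (QuotientGroup.map H H φ hH)

/-- The Addition Theorem `AT(G,φ,H)`:
`h(φ) = h(φ↾_H) + h(φ̄)` where `φ̄` is induced by `φ` on `G ⧸ H`. -/
def AT (φ : G →* G) (H : Subgroup G) (hN : H.Normal) (hH : H ≤ H.comap φ) : Prop :=
  algEnt φ = algEnt (endRestrict φ H hH) + entQuot φ H hN hH

lemma commutator_le_comap (φ : G →* G) :
    commutator G ≤ (commutator G).comap φ := by
  rw [← Subgroup.map_le_iff_le_comap]
  calc Subgroup.map φ (commutator G) = ⁅Subgroup.map φ ⊤, Subgroup.map φ ⊤⁆ :=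
        Subgroup.map_commutator ⊤ ⊤ φ
    _ ≤ commutator G := Subgroup.commutator_mono le_top le_top

lemma normal_of_le_center {N : Subgroup G} (h : N ≤ Subgroup.center G) : N.Normal := by
  constructor
  intro n hn g
  have hc := Subgroup.mem_center_iff.mp (h hn) g
  have : g * n * g⁻¹ = n := by
    rw [hc]; group
  rwa [this]

lemma center_le_comap_equiv (φ : G ≃* G) :
    Subgroup.center G ≤ (Subgroup.center G).comap φ.toMonoidHom := by
  intro x hx
  simp only [Subgroup.mem_comap]
  refine Subgroup.mem_center_iff.mpr fun g => ?_
  have hg : φ (φ.symm g) = g := φ.apply_symm_apply g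
  calc g * φ x = φ (φ.symm g) * φ x := by rw [hg]
    _ = φ (φ.symm g * x) := by rw [map_mul]
    _ = φ (x * φ.symm g) := by rw [Subgroup.mem_center_iff.mp hx (φ.symm g)]
    _ = φ x * g := by rw [map_mul, hg]

lemma lowerCentralSeries_le_comap (φ : G →* G) (n : ℕ) :
    Subgroup.lowerCentralSeries (⊤ : Subgroup G) n ≤ (Subgroup.lowerCentralSeries (⊤ : Subgroup G) n).comap φ := by
  rw [← Subgroup.map_le_iff_le_comap]
  induction n with
  | zero => exact le_top
  | succ n ih =>
      show Subgroup.map φ ⁅Subgroup.lowerCentralSeries (⊤ : Subgroup G) n, ⊤⁆ ≤ ⁅Subgroup.lowerCentralSeries (⊤ : Subgroup G) n, ⊤⁆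
      rw [Subgroup.map_commutator]
      exact Subgroup.commutator_mono ih le_top

lemma upperCentralSeries_le_comap (φ : G ≃* G) (n : ℕ) :
    Subgroup.upperCentralSeries G n ≤ (Subgroup.upperCentralSeries G n).comap φ.toMonoidHom := by
  have := Subgroup.comap_upperCentralSeries φ n
  -- `(upperCentralSeries G n).comap φ = upperCentralSeries G n`
  exact le_of_eq this.symm

end AlgEntropy

namespace AlgEntropy

open Filter Topology

section helpers
variable {G A Q : Type*} [Group G] [Group A] [Group Q]

lemma image_iter_mul (φ : G →* G) (m : ℕ) (S T : Set G) :
    (⇑φ)^[m] '' (S * T) = (⇑φ)^[m] '' S * (⇑φ)^[m] '' T :=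
  Set.image_image2_distrib (fun a b => iterate_map_mul φ m a b)

lemma entTraj_finite (φ : G →* G) {F : Set G} (hF : F.Finite) (n : ℕ) :
    (entTraj φ F n).Finite := by
  induction n with
  | zero => exact Set.finite_singleton 1
  | succ n ih => exact ih.mul (hF.image _)

lemma one_mem_entTraj (φ : G →* G) {F : Set G} (hF : (1 : G) ∈ F) (n : ℕ) :
    (1 : G) ∈ entTraj φ F n := by
  induction n with
  | zero => exact Set.mem_singleton 1
  | succ n ih => exact ⟨1, ih, 1, ⟨1, hF, iterate_map_one φ n⟩, mul_one 1⟩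

lemma entTraj_mono (φ : G →* G) {F F' : Set G} (h : F ⊆ F') (n : ℕ) :
    entTraj φ F n ⊆ entTraj φ F' n := by
  induction n with
  | zero => exact subset_rfl
  | succ n ih => exact Set.mul_subset_mul ih (Set.image_mono h)

lemma entTraj_mono_nat (φ : G →* G) {F : Set G} (hF : (1 : G) ∈ F) {m n : ℕ} (h : m ≤ n) :
    entTraj φ F m ⊆ entTraj φ F n := by
  induction n, h using Nat.le_induction with
  | base => exact subset_rfl
  | succ n _ ih =>
    intro x hx
    exact ⟨x, ih hx, 1, ⟨1, hF, iterate_map_one φ n⟩, mul_one x⟩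

lemma entTraj_add (φ : G →* G) (F : Set G) (m n : ℕ) :
    entTraj φ F (m + n) = entTraj φ F m * (⇑φ)^[m] '' entTraj φ F n := by
  induction n with
  | zero => simp [entTraj, iterate_map_one]
  | succ n ih =>
    show entTraj φ F (m + n) * (⇑φ)^[m + n] '' F =
      entTraj φ F m * (⇑φ)^[m] '' (entTraj φ F n * (⇑φ)^[n] '' F)
    rw [ih, image_iter_mul, mul_assoc, Function.iterate_add, Set.image_comp]

lemma entTraj_image (f : A →* G) (α : A →* A) (φ : G →* G) (h : ∀ a, f (α a) = φ (f a))
    (F : Set A) (n : ℕ) : f '' entTraj α F n = entTraj φ (f '' F) n := by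
  induction n with
  | zero => simp [entTraj]
  | succ n ih =>
    show f '' (entTraj α F n * (⇑α)^[n] '' F) = entTraj φ (f '' F) n * (⇑φ)^[n] '' (f '' F)
    have hs : Function.Semiconj f α φ := h
    rw [Set.image_mul, ih, Set.image_image, Set.image_image]
    congr 1
    exact Set.image_congr fun a _ => (hs.iterate_right n) a

lemma entTraj_ncard_pos (φ : G →* G) {F : Set G} (hF : F.Finite) (h1 : (1 : G) ∈ F) (n : ℕ) :
    0 < (entTraj φ F n).ncard :=
  (Set.ncard_pos (entTraj_finite φ hF n)).2 ⟨1, one_mem_entTraj φ h1 n⟩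

lemma ncard_mul_le' (S T : Set G) : (S * T).ncard ≤ S.ncard * T.ncard := by
  simpa [Nat.card_coe_set_eq] using Set.natCard_mul_le (s := S) (t := T)

lemma entTraj_subadd (φ : G →* G) {F : Set G} (hF : F.Finite) (h1 : (1 : G) ∈ F) :
    Subadditive (fun n : ℕ => Real.log (entTraj φ F n).ncard) := by
  intro m n
  have p := entTraj_ncard_pos φ hF h1
  rw [← Real.log_mul (by exact_mod_cast (p m).ne') (by exact_mod_cast (p n).ne')]
  apply Real.log_le_log (by exact_mod_cast p _)
  norm_cast
  rw [entTraj_add]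
  refine (ncard_mul_le' _ _).trans (Nat.mul_le_mul_left _ ?_)
  exact Set.ncard_image_le (entTraj_finite φ hF n)

lemma entH_tendsto (φ : G →* G) (F : Subgroup G) (hF : (F : Set G).Finite) :
    Tendsto (fun n : ℕ => Real.log (entTraj φ (F : Set G) n).ncard / n) atTop
      (𝓝 (entH φ F)) := by
  have h := (entTraj_subadd φ hF F.one_mem).tendsto_lim
    ⟨0, by rintro _ ⟨n, rfl⟩; positivity⟩
  unfold entH
  rwa [h.limsup_eq]

lemma entH_nonneg (φ : G →* G) (F : Subgroup G) (hF : (F : Set G).Finite) : 0 ≤ entH φ F :=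
  ge_of_tendsto' (entH_tendsto φ F hF) fun n => by positivity

lemma entH_le_algEnt (φ : G →* G) (F : Subgroup G) (hF : (F : Set G).Finite) :
    ENNReal.ofReal (entH φ F) ≤ algEnt φ :=
  le_iSup₂ (f := fun (F : Subgroup G) (_ : (F : Set G).Finite) => ENNReal.ofReal (entH φ F)) F hF

lemma IsLocallyFinite.of_injective (hG : IsLocallyFinite G) (f : A →* G)
    (hf : Function.Injective f) : IsLocallyFinite A := by
  intro S hS
  have := hG (f '' S) (hS.image f)
  rw [← MonoidHom.map_closure] at this
  exact Set.Finite.of_finite_image this hf.injOn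

lemma IsLocallyFinite.of_surjective (hG : IsLocallyFinite G) (f : G →* Q)
    (hf : Function.Surjective f) : IsLocallyFinite Q := by
  intro S hS
  obtain ⟨T, hT, rfl⟩ : ∃ T : Set G, T.Finite ∧ f '' T = S :=
    ⟨Function.surjInv hf '' S, hS.image _, by
      rw [Set.image_image]; simp [Function.surjInv_eq hf]⟩
  rw [← MonoidHom.map_closure]
  exact (hG T hT).image f

lemma entTraj_mul_central (φ : G →* G) (S : Set G) (f : A →* G) (α : A →* A)
    (h : ∀ a, f (α a) = φ (f a)) (hc : f.range ≤ Subgroup.center G) (K : Set A) (n : ℕ) :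
    entTraj φ (S * f '' K) n = entTraj φ S n * f '' entTraj α K n := by
  have hs : Function.Semiconj f α φ := h
  have hcomm : ∀ (X : Set A) (Y : Set G), f '' X * Y = Y * f '' X := by
    intro X Y
    ext z
    constructor
    · rintro ⟨_, ⟨a, ha, rfl⟩, y, hy, rfl⟩
      exact ⟨y, hy, f a, ⟨a, ha, rfl⟩, Subgroup.mem_center_iff.1 (hc ⟨a, rfl⟩) y⟩
    · rintro ⟨y, hy, _, ⟨a, ha, rfl⟩, rfl⟩
      exact ⟨f a, ⟨a, ha, rfl⟩, y, hy, (Subgroup.mem_center_iff.1 (hc ⟨a, rfl⟩) y).symm⟩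
  induction n with
  | zero => simp [entTraj]
  | succ n ih =>
    show entTraj φ (S * f '' K) n * (⇑φ)^[n] '' (S * f '' K) =
      (entTraj φ S n * (⇑φ)^[n] '' S) * f '' (entTraj α K n * (⇑α)^[n] '' K)
    have e : (⇑φ)^[n] '' (f '' K) = f '' ((⇑α)^[n] '' K) := by
      rw [Set.image_image, Set.image_image]
      exact Set.image_congr fun a _ => ((hs.iterate_right n) a).symm
    rw [ih, image_iter_mul, Set.image_mul, e, mul_assoc, ← mul_assoc (f '' _), hcomm]
    simp only [mul_assoc]

theorem algEnt_central_ge (hG : IsLocallyFinite G) (f : A →* G) (hf : Function.Injective f)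
    (g : G →* Q) (hg : Function.Surjective g) (hk : f.range = g.ker)
    (hc : f.range ≤ Subgroup.center G) (α : A →* A) (φ : G →* G) (β : Q →* Q)
    (hα : ∀ a, f (α a) = φ (f a)) (hβ : ∀ x, g (φ x) = β (g x)) :
    algEnt α + algEnt β ≤ algEnt φ := by
  refine ENNReal.biSup_add_biSup_le' ⟨⊥, by simp⟩ ⟨⊥, by simp⟩ ?_
  intro F hF E hE
  obtain ⟨S, hS, hSE⟩ : ∃ T : Set G, T.Finite ∧ g '' T = (E : Set Q) :=
    ⟨Function.surjInv hg '' E, hE.image _, by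
      rw [Set.image_image]; simp [Function.surjInv_eq hg]⟩
  have hW := hG (S ∪ f '' F) (hS.union (hF.image f))
  set W := Subgroup.closure (S ∪ f '' (F : Set A)) with hWd
  refine le_trans ?_ (entH_le_algEnt φ W hW)
  rw [← ENNReal.ofReal_add (entH_nonneg α F hF) (entH_nonneg β E hE)]
  apply ENNReal.ofReal_le_ofReal
  refine le_of_tendsto_of_tendsto' ((entH_tendsto α F hF).add (entH_tendsto β E hE))
    (entH_tendsto φ W hW) fun n => ?_
  rw [← add_div]
  gcongr
  have p1 := entTraj_ncard_pos α hF F.one_mem n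
  have p2 := entTraj_ncard_pos β hE E.one_mem n
  rw [← Real.log_mul (by exact_mod_cast p1.ne') (by exact_mod_cast p2.ne')]
  apply Real.log_le_log (by positivity)
  norm_cast
  have hsub : S * f '' (F : Set A) ⊆ (W : Set G) := by
    rintro _ ⟨s, hs, t, ht, rfl⟩
    exact W.mul_mem (Subgroup.subset_closure (Or.inl hs)) (Subgroup.subset_closure (Or.inr ht))
  have h1 := entTraj_mono φ hsub n
  rw [entTraj_mul_central φ S f α hα hc] at h1
  have h2 : g '' entTraj φ S n = entTraj β E n := by
    rw [entTraj_image g φ β hβ, hSE]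
  have h3 : ∀ q ∈ entTraj β (E : Set Q) n, ∃ x ∈ entTraj φ S n, g x = q := by
    intro q hq; rw [← h2] at hq; exact hq
  choose! s hs1 hs2 using h3
  have hga : ∀ a, g (f a) = 1 := fun a => by
    have : f a ∈ g.ker := hk ▸ ⟨a, rfl⟩
    exact this
  rw [← Set.ncard_prod]
  refine Set.ncard_le_ncard_of_injOn (fun p => s p.2 * f p.1) ?_ ?_ (entTraj_finite φ hW n)
  · rintro ⟨a, q⟩ ⟨ha, hq⟩
    exact h1 ⟨_, hs1 q hq, _, ⟨a, ha, rfl⟩, rfl⟩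
  · rintro ⟨a, q⟩ ⟨ha, hq⟩ ⟨a', q'⟩ ⟨ha', hq'⟩ heq
    simp only at heq ha hq ha' hq'
    have e := congrArg g heq
    simp only [map_mul, hga, mul_one] at e
    rw [hs2 q hq, hs2 q' hq'] at e
    subst e
    have := hf (mul_left_cancel heq)
    rw [this]

lemma entH_central_le (hG : IsLocallyFinite G) (f : A →* G) (hf : Function.Injective f)
    (g : G →* Q) (hk : f.range = g.ker)
    (hc : f.range ≤ Subgroup.center G) (α : A →* A) (φ : G →* G) (β : Q →* Q)
    (hα : ∀ a, f (α a) = φ (f a)) (hβ : ∀ x, g (φ x) = β (g x))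
    (F : Subgroup G) (hF : (F : Set G).Finite) (k : ℕ) (hk0 : 0 < k) :
    ∃ K : Subgroup A, (K : Set A).Finite ∧
      entH φ F ≤ Real.log (entTraj β (F.map g : Set Q) k).ncard / k + entH α K := by
  have hfin := entTraj_finite φ hF k
  have hK := IsLocallyFinite.of_injective hG f hf
    (f ⁻¹' ((entTraj φ F k)⁻¹ * entTraj φ F k)) ((hfin.inv.mul hfin).preimage hf.injOn)
  set K := Subgroup.closure (f ⁻¹' ((entTraj φ (F : Set G) k)⁻¹ * entTraj φ F k))
  have hE : (F.map g : Set Q).Finite := by simpa using hF.image g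
  have him : g '' entTraj φ F k = entTraj β (F.map g : Set Q) k := by
    rw [entTraj_image g φ β hβ]; simp
  set E : Set Q := (F.map g : Set Q) with hEd
  have h3 : ∀ q ∈ entTraj β E k, ∃ x ∈ entTraj φ (F : Set G) k, g x = q := by
    intro q hq; rw [← him] at hq; exact hq
  choose! s hs1 hs2 using h3
  set S : Set G := s '' entTraj β E k
  have hEk := entTraj_finite β hE k
  have hScard : S.ncard ≤ (entTraj β E k).ncard := Set.ncard_image_le hEk
  have hcov : entTraj φ (F : Set G) k ⊆ S * f '' (K : Set A) := by
    intro x hx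
    have hq : g x ∈ entTraj β E k := him ▸ ⟨x, hx, rfl⟩
    have hm : (s (g x))⁻¹ * x ∈ f.range := by
      rw [hk, MonoidHom.mem_ker, map_mul, map_inv, hs2 _ hq, inv_mul_cancel]
    obtain ⟨a, ha⟩ := hm
    refine ⟨s (g x), ⟨_, hq, rfl⟩, f a, ⟨a, Subgroup.subset_closure ?_, rfl⟩, ?_⟩
    · show f a ∈ (entTraj φ (F : Set G) k)⁻¹ * entTraj φ (F : Set G) k
      rw [ha]
      exact Set.mul_mem_mul (Set.inv_mem_inv.2 (hs1 _ hq)) hx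
    · show s (g x) * f a = x
      rw [ha, mul_inv_cancel_left]
  have hs : Function.Semiconj f α φ := hα
  have main : ∀ n : ℕ, ∃ P : Set G, P.Finite ∧ P.ncard ≤ (entTraj β E k).ncard ^ n ∧
      entTraj φ (F : Set G) (k * n) ⊆ P * f '' entTraj α K (k * n) := by
    intro n
    induction n with
    | zero => exact ⟨{1}, by simp, by simp, by simp [entTraj]⟩
    | succ n ih =>
      obtain ⟨P, hP, hPc, hPs⟩ := ih
      have hSf : S.Finite := hEk.image s
      refine ⟨P * (⇑φ)^[k * n] '' S, hP.mul (hSf.image _), ?_, ?_⟩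
      · rw [pow_succ]
        exact (ncard_mul_le' _ _).trans
          (Nat.mul_le_mul hPc ((Set.ncard_image_le hSf).trans hScard))
      · rw [Nat.mul_succ, entTraj_add]
        rintro _ ⟨x, hx, _, ⟨y, hy, rfl⟩, rfl⟩
        obtain ⟨p, hp, _, ⟨a, ha, rfl⟩, rfl⟩ := hPs hx
        obtain ⟨t, ht, _, ⟨b, hb, rfl⟩, rfl⟩ := hcov hy
        refine ⟨p * (⇑φ)^[k * n] t, ⟨p, hp, _, ⟨t, ht, rfl⟩, rfl⟩,
          f (a * (⇑α)^[k * n] b), ⟨_, ?_, rfl⟩, ?_⟩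
        · exact entTraj_mono_nat α K.one_mem (show k * n + 1 ≤ k * n + k by omega)
            ⟨a, ha, _, ⟨b, hb, rfl⟩, rfl⟩
        · have e1 : f ((⇑α)^[k * n] b) = (⇑φ)^[k * n] (f b) := (hs.iterate_right _) b
          have e2 := Subgroup.mem_center_iff.1 (hc ⟨a, rfl⟩) ((⇑φ)^[k * n] t)
          show p * (⇑φ)^[k * n] t * f (a * (⇑α)^[k * n] b) =
            p * f a * (⇑φ)^[k * n] (t * f b)
          rw [map_mul, e1, iterate_map_mul, mul_assoc, ← mul_assoc _ (f a), e2]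
          simp only [mul_assoc]
  refine ⟨K, hK, ?_⟩
  have hsub : Tendsto (fun n : ℕ => k * n) atTop atTop :=
    tendsto_id.const_mul_atTop' hk0
  refine le_of_tendsto_of_tendsto ((entH_tendsto φ F hF).comp hsub)
    (((entH_tendsto α K hK).comp hsub).const_add _) ?_
  filter_upwards [eventually_gt_atTop 0] with n hn
  obtain ⟨P, hP, hPc, hPs⟩ := main n
  have p0 := entTraj_ncard_pos φ hF F.one_mem (k * n)
  have p1 := entTraj_ncard_pos β hE (F.map g).one_mem k
  have p2 := entTraj_ncard_pos α hK K.one_mem (k * n)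
  have hfinK := entTraj_finite α hK (k * n)
  have hle : (entTraj φ (F : Set G) (k * n)).ncard ≤
      (entTraj β E k).ncard ^ n * (entTraj α (K : Set A) (k * n)).ncard :=
    (Set.ncard_le_ncard hPs (hP.mul (hfinK.image f))).trans
      ((ncard_mul_le' _ _).trans (Nat.mul_le_mul hPc (Set.ncard_image_le hfinK)))
  have hlog : Real.log (entTraj φ (F : Set G) (k * n)).ncard ≤
      n * Real.log (entTraj β E k).ncard + Real.log (entTraj α (K : Set A) (k * n)).ncard := by
    rw [← Real.log_pow, ← Real.log_mul (by positivity) (by positivity)]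
    exact Real.log_le_log (by positivity) (by exact_mod_cast hle)
  have hk' : (0 : ℝ) < k := by exact_mod_cast hk0
  have hn' : (0 : ℝ) < n := by exact_mod_cast hn
  show _ / ((k * n : ℕ) : ℝ) ≤ _ + _ / ((k * n : ℕ) : ℝ)
  have e : Real.log (entTraj β E k).ncard / k =
      n * Real.log (entTraj β E k).ncard / ((k * n : ℕ) : ℝ) := by
    push_cast; field_simp
  rw [e, ← add_div]
  gcongr

theorem algEnt_central (hG : IsLocallyFinite G) (f : A →* G) (hf : Function.Injective f)
    (g : G →* Q) (hg : Function.Surjective g) (hk : f.range = g.ker)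
    (hc : f.range ≤ Subgroup.center G) (α : A →* A) (φ : G →* G) (β : Q →* Q)
    (hα : ∀ a, f (α a) = φ (f a)) (hβ : ∀ x, g (φ x) = β (g x)) :
    algEnt φ = algEnt α + algEnt β := by
  refine le_antisymm ?_ (algEnt_central_ge hG f hf g hg hk hc α φ β hα hβ)
  refine iSup₂_le fun F hF => ?_
  have hE : (F.map g : Set Q).Finite := by simpa using hF.image g
  have key : ENNReal.ofReal (entH φ F) ≤ algEnt α + ENNReal.ofReal (entH β (F.map g)) := by
    refine ge_of_tendsto ((ENNReal.tendsto_ofReal (entH_tendsto β (F.map g) hE)).const_add _) ?_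
    filter_upwards [eventually_gt_atTop 0] with k hk0
    obtain ⟨K, hK, hle⟩ := entH_central_le hG f hf g hk hc α φ β hα hβ F hF k hk0
    refine (ENNReal.ofReal_le_ofReal hle).trans (ENNReal.ofReal_add_le.trans ?_)
    rw [add_comm]
    gcongr
    exact entH_le_algEnt α K hK
  exact key.trans (by gcongr; exact entH_le_algEnt β _ hE)

end helpers

universe u v

theorem algEnt_ucs (n : ℕ) : ∀ {G : Type u} {Q : Type v} [Group G] [Group Q]
    (_ : IsLocallyFinite G) (φ : G →* G) (_ : Function.Surjective φ) (g : G →* Q)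
    (_ : Function.Surjective g) (_ : g.ker = Subgroup.upperCentralSeries G n)
    (β : Q →* Q) (_ : ∀ x, g (φ x) = β (g x))
    (hinv : Subgroup.upperCentralSeries G n ≤ (Subgroup.upperCentralSeries G n).comap φ),
    algEnt φ = algEnt (endRestrict φ _ hinv) + algEnt β := by
  induction n with
  | zero =>
    intro G Q _ _ hG φ hφ g hg hk β hβ hinv
    exact algEnt_central hG (Subgroup.subtype _) (Subgroup.subtype_injective _) g hg
      (by rw [hk, Subgroup.range_subtype])
      (by rw [Subgroup.range_subtype, Subgroup.upperCentralSeries_zero]; exact bot_le)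
      _ φ β (fun a => rfl) hβ
  | succ n ih =>
    intro G Q _ _ hG φ hφ g hg hk β hβ hinv
    have hZ : Subgroup.center G ≤ (Subgroup.center G).comap φ := by
      intro x hx
      refine Subgroup.mem_center_iff.2 fun y => ?_
      obtain ⟨y, rfl⟩ := hφ y
      rw [← map_mul, ← map_mul, Subgroup.mem_center_iff.1 hx y]
    let Z := Subgroup.center G
    let π : G →* G ⧸ Z := QuotientGroup.mk' Z
    have hπ : Function.Surjective π := QuotientGroup.mk'_surjective Z
    have hπk : π.ker = Z := QuotientGroup.ker_mk' Z
    let φ' : G ⧸ Z →* G ⧸ Z := QuotientGroup.map Z Z φ hZ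
    have hφ' : Function.Surjective φ' := by
      intro y
      obtain ⟨y, rfl⟩ := hπ y
      obtain ⟨x, rfl⟩ := hφ y
      exact ⟨π x, rfl⟩
    have hcm : (Subgroup.upperCentralSeries (G ⧸ Z) n).comap π =
        Subgroup.upperCentralSeries G (n + 1) := Subgroup.comap_upperCentralSeries_quotient_center n
    have hZle : Z ≤ Subgroup.upperCentralSeries G (n + 1) := by
      rw [← hcm]
      intro x hx
      have hx1 : π x = 1 := MonoidHom.mem_ker.1 (by rw [hπk]; exact hx)
      rw [Subgroup.mem_comap, hx1]
      exact one_mem _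
    have hZg : Z ≤ g.ker := hk ▸ hZle
    have hinv' : Subgroup.upperCentralSeries (G ⧸ Z) n ≤
        (Subgroup.upperCentralSeries (G ⧸ Z) n).comap φ' := by
      intro y hy
      obtain ⟨x, rfl⟩ := hπ y
      have hx : x ∈ Subgroup.upperCentralSeries G (n + 1) := by rw [← hcm]; exact hy
      have := hinv hx
      rw [← hcm] at this
      exact this
    let g' : G ⧸ Z →* Q := QuotientGroup.lift Z g hZg
    have hLF : IsLocallyFinite (G ⧸ Z) := IsLocallyFinite.of_surjective hG π hπ
    have s1 : algEnt φ = algEnt (endRestrict φ Z hZ) + algEnt φ' :=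
      algEnt_central hG Z.subtype (Subgroup.subtype_injective _) π hπ
        (by rw [hπk, Subgroup.range_subtype]) (by rw [Subgroup.range_subtype])
        _ φ φ' (fun a => rfl) (fun x => rfl)
    have s2 : algEnt φ' = algEnt (endRestrict φ' _ hinv') + algEnt β := by
      refine ih hLF φ' hφ' g' ?_ ?_ β ?_ hinv'
      · intro q
        obtain ⟨x, rfl⟩ := hg q
        exact ⟨π x, rfl⟩
      · ext y
        obtain ⟨x, rfl⟩ := hπ y
        have e : x ∈ g.ker ↔ π x ∈ Subgroup.upperCentralSeries (G ⧸ Z) n := by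
          rw [hk, ← hcm]; rfl
        exact e
      · intro y
        obtain ⟨x, rfl⟩ := hπ y
        exact hβ x
    let B := Subgroup.upperCentralSeries G (n + 1)
    let B' := Subgroup.upperCentralSeries (G ⧸ Z) n
    have hBB : ∀ x : B, π x ∈ B' := fun x => by
      have : (x : G) ∈ Subgroup.upperCentralSeries G (n + 1) := x.2
      rw [← hcm] at this
      exact this
    let ρ : B →* B' := (π.comp B.subtype).codRestrict B' hBB
    have s3 : algEnt (endRestrict φ B hinv) =
        algEnt (endRestrict φ Z hZ) + algEnt (endRestrict φ' B' hinv') := by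
      refine algEnt_central (IsLocallyFinite.of_injective hG B.subtype
        (Subgroup.subtype_injective _)) (Subgroup.inclusion hZle)
        (Subgroup.inclusion_injective _) ρ ?_ ?_ ?_ _ _ _ (fun a => rfl) (fun x => rfl)
      · rintro ⟨y, hy⟩
        obtain ⟨x, rfl⟩ := hπ y
        exact ⟨⟨x, hcm.le hy⟩, rfl⟩
      · ext x
        constructor
        · rintro ⟨a, rfl⟩
          apply Subtype.ext
          show π a = 1
          have : (a : G) ∈ π.ker := by rw [hπk]; exact a.2
          exact this
        · intro hx
          have h1 : π x = 1 := congrArg Subtype.val (MonoidHom.mem_ker.1 hx)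
          have h2 : (x : G) ∈ Z := by rw [← hπk]; exact h1
          exact ⟨⟨x, h2⟩, rfl⟩
      · rintro _ ⟨a, rfl⟩
        refine Subgroup.mem_center_iff.2 fun y => Subtype.ext ?_
        exact Subgroup.mem_center_iff.1 a.2 (y : G)
    rw [s1, s2, s3, add_assoc]

end AlgEntropy

/-- Addition Theorem for the `n`-center, automorphisms. For every
locally finite group `G`, every automorphism `φ` and every `n ≥ 1`,
`h(φ) = h(φ↾_{Z_n(G)}) + h(φ̄)` where `φ̄` is induced on `G/Z_n(G)`. -/
theorem algEnt_eq_upperCentral_aut {G : Type*} [Group G] (hG : IsLocallyFinite G)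
    (φ : G ≃* G) (n : ℕ) (hn : 0 < n) :
    AlgEntropy.algEnt φ.toMonoidHom =
      AlgEntropy.algEnt (AlgEntropy.endRestrict φ.toMonoidHom (Subgroup.upperCentralSeries G n)
        (AlgEntropy.upperCentralSeries_le_comap φ n)) +
      AlgEntropy.entQuot φ.toMonoidHom (Subgroup.upperCentralSeries G n) inferInstance
        (AlgEntropy.upperCentralSeries_le_comap φ n) := by
  exact AlgEntropy.algEnt_ucs n hG φ.toMonoidHom φ.surjective
    (QuotientGroup.mk' (Subgroup.upperCentralSeries G n)) (QuotientGroup.mk'_surjective _)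
    (QuotientGroup.ker_mk' _) _ (fun x => rfl) (AlgEntropy.upperCentralSeries_le_comap φ n)
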